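/- (Gallagher) There is an absolute constant C such that for all real Δ, N, N' with 2 < Δ < N/2 and N < N' < 2N, and every complex sequence (a_n): ∫_{|β| < Δ^{-1}} | Σ_{N < n < N'} a_n e(βn) |^2 dβ ≤ C Δ^{-2} ∫_{N - Δ/2}^{N'} | Σ_{max{t, N} < n < min{t + Δ/2, N'}} a_n |^2 dt. -/

import Mathlib

open Finset MeasureTheory

/-- `ee θ = e(θ) = exp(2πiθ)`. -/
noncomputable def ee (θ : ℝ) : ℂ := Complex.exp (2 * Real.pi * Complex.I * θ)

open FourierTransform SchwartzMap ContDiff in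
lemma planch_ae (f : ℝ → ℂ) (h1 : Integrable f) (h2 : MemLp f 2) :
    𝓕 f =ᵐ[volume] (𝓕 (h2.toLp f) : Lp (α := ℝ) ℂ 2) := by
  set g : Lp (α := ℝ) ℂ 2 volume := 𝓕 (h2.toLp f) with hg
  have hc : Continuous (𝓕 f) := VectorFourier.fourierIntegral_continuous
    Real.continuous_fourierChar (by fun_prop) h1
  refine ae_eq_of_integral_contDiff_smul_eq hc.locallyIntegrable
    ((Lp.memLp g).locallyIntegrable (by norm_num)) ?_
  intro φ hφ hs
  have hs' : HasCompactSupport (fun x => (φ x : ℂ)) := hs.comp_left (g := fun x : ℝ => (x:ℂ)) (by simp)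
  have hφ' : ContDiff ℝ ∞ (fun x => (φ x : ℂ)) := Complex.ofRealCLM.contDiff.comp hφ
  set ψ : 𝓢(ℝ, ℂ) := hs'.toSchwartzMap hφ' with hψ
  have key := congrArg (fun T => T ψ) (Lp.fourier_toTemperedDistribution_eq (h2.toLp f))
  simp only [TemperedDistribution.fourier_apply, Lp.toTemperedDistribution_apply] at key
  have e1 : ∫ x, φ x • g x = ∫ x, ψ x • g x := by
    refine integral_congr_ae (Filter.Eventually.of_forall fun x => ?_)
    simp [hψ]
  rw [e1, hg, ← key]
  have e2 : ∫ x, (𝓕 ψ) x • (h2.toLp f) x = ∫ x, (𝓕 ψ) x • f x := by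
    refine integral_congr_ae ?_
    filter_upwards [h2.coeFn_toLp] with x hx
    rw [hx]
  rw [e2]
  have e3 : ∫ x, (𝓕 (ψ : ℝ → ℂ)) x • f x = ∫ x, ψ x • (𝓕 f) x := by
    have := VectorFourier.integral_fourierIntegral_smul_eq_flip (μ := volume) (ν := volume)
      (L := innerₗ ℝ) Real.continuous_fourierChar (by fun_prop) ψ.integrable h1
    rw [flip_innerₗ] at this
    exact this
  rw [SchwartzMap.fourier_coe, e3]
  refine integral_congr_ae (Filter.Eventually.of_forall fun x => ?_)
  simp [hψ]

open FourierTransform in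
lemma planch (f : ℝ → ℂ) (h1 : Integrable f) (h2 : MemLp f 2) :
    Integrable (fun x => ‖𝓕 f x‖ ^ 2) ∧ ∫ x, ‖𝓕 f x‖ ^ 2 = ∫ x, ‖f x‖ ^ 2 := by
  have h := planch_ae f h1 h2
  have hm : MemLp (𝓕 f) 2 := (memLp_congr_ae h).2 (Lp.memLp _)
  have e : hm.toLp (𝓕 f) = 𝓕 (h2.toLp f) := by
    apply Lp.ext
    exact hm.coeFn_toLp.trans h
  have nn : ‖hm.toLp (𝓕 f)‖ = ‖h2.toLp f‖ := by rw [e, Lp.norm_fourier_eq]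
  have L2 : ∀ (u : ℝ → ℂ) (hu : MemLp u 2), ‖hu.toLp u‖ ^ 2 = ∫ x, ‖u x‖ ^ 2 := by
    intro u hu
    have := L2.inner_def (𝕜 := ℂ) (hu.toLp u) (hu.toLp u)
    rw [inner_self_eq_norm_sq_to_K] at this
    have e : ∫ x, inner ℂ ((hu.toLp u) x) ((hu.toLp u) x) = ((∫ x, ‖u x‖ ^ 2 : ℝ) : ℂ) := by
      rw [← integral_complex_ofReal]
      refine integral_congr_ae ?_
      filter_upwards [hu.coeFn_toLp] with x hx
      rw [hx, inner_self_eq_norm_sq_to_K]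
      simp
    rw [e] at this
    exact Complex.ofReal_injective (by simpa using this)
  refine ⟨hm.integrable_norm_pow (by norm_num), ?_⟩
  rw [← L2 _ hm, ← L2 _ h2, nn]

lemma ee_eq (θ : ℝ) : ee θ = Complex.exp ((2 * Real.pi * θ : ℝ) * Complex.I) := by
  unfold ee; congr 1; push_cast; ring

lemma ee_add (x y : ℝ) : ee (x + y) = ee x * ee y := by
  unfold ee; rw [← Complex.exp_add]; congr 1; push_cast; ring

lemma ee_norm (x : ℝ) : ‖ee x‖ = 1 := by
  rw [ee_eq, Complex.norm_exp_ofReal_mul_I]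

lemma ee_cont : Continuous ee := by unfold ee; fun_prop

lemma kernel_lower (h β : ℝ) (hh : 0 < h) (hβ : |β| * h ≤ 1 / 2) :
    h / 2 ≤ ‖∫ u in (0:ℝ)..h, ee (-(β * u))‖ := by
  have hc : ∀ c d : ℝ, Continuous fun u : ℝ => ee (c * u + d) := fun c d => 
    ee_cont.comp (by fun_prop)
  have e1 : ‖∫ u in (0:ℝ)..h, ee (-(β * u))‖ = ‖∫ u in (0:ℝ)..h, ee ((-β) * u + β * h / 2)‖ := by
    have : ∀ u, ee ((-β) * u + β * h / 2) = ee (-(β * u)) * ee (β * h / 2) := by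
      intro u; rw [← ee_add]; congr 1; ring
    simp_rw [this]
    rw [intervalIntegral.integral_mul_const, norm_mul, ee_norm, mul_one]
  rw [e1]
  refine le_trans ?_ (Complex.re_le_norm _)
  have e2 : (∫ u in (0:ℝ)..h, ee ((-β) * u + β * h / 2)).re
      = ∫ u in (0:ℝ)..h, Real.cos (2 * Real.pi * ((-β) * u + β * h / 2)) := by
    have := Complex.reCLM.intervalIntegral_comp_comm 
      ((hc (-β) (β * h / 2)).intervalIntegrable (μ := volume) 0 h)
    simp only [Complex.reCLM_apply] at this
    rw [← this]
    congr 1; ext u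
    rw [ee_eq, Complex.exp_ofReal_mul_I_re]
  rw [e2]
  have e3 : ∫ u in (0:ℝ)..h, (1 - (2 * Real.pi ^ 2 * β ^ 2) * (u - h / 2) ^ 2)
      = h - Real.pi ^ 2 * β ^ 2 * h ^ 3 / 6 := by
    rw [intervalIntegral.integral_sub (by simp) (by apply Continuous.intervalIntegrable; fun_prop),
      intervalIntegral.integral_const_mul,
      intervalIntegral.integral_comp_sub_right (fun x => x ^ 2)]
    simp
    ring
  calc h / 2 ≤ h - Real.pi ^ 2 * β ^ 2 * h ^ 3 / 6 := by
        have p : Real.pi ^ 2 ≤ 12 := by nlinarith [Real.pi_lt_d2, Real.pi_pos]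
        have q : β ^ 2 * h ^ 2 ≤ 1 / 4 := by
          have : (|β| * h) ^ 2 ≤ (1 / 2) ^ 2 := by gcongr
          rw [mul_pow, sq_abs] at this; linarith
        have r : Real.pi ^ 2 * (β ^ 2 * h ^ 2) ≤ 12 * (1 / 4) := by gcongr
        nlinarith
    _ = _ := e3.symm
    _ ≤ _ := by
        refine intervalIntegral.integral_mono_on hh.le
          (by apply Continuous.intervalIntegrable; fun_prop)
          (by apply Continuous.intervalIntegrable; fun_prop) ?_
        intro u _
        have := Real.one_sub_sq_div_two_le_cos (x := 2 * Real.pi * ((-β) * u + β * h / 2))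
        refine le_trans (le_of_eq ?_) this
        ring

/-- The (reflected) window function. -/
noncomputable def gw (h : ℝ) (s : Finset ℕ) (a : ℕ → ℂ) (t : ℝ) : ℂ :=
  ∑ n ∈ s, (Set.Ioo (-(n:ℝ)) (-(n:ℝ) + h)).indicator (fun _ => a n) t

lemma gw_memLp (h : ℝ) (s : Finset ℕ) (a : ℕ → ℂ) (p : ENNReal) : MemLp (gw h s a) p := by
  unfold gw
  refine memLp_finsetSum _ fun n _ => memLp_indicator_const _ measurableSet_Ioo _ (Or.inr ?_)
  simp

open FourierTransform in
lemma gw_fourier (h : ℝ) (hh : 0 < h) (s : Finset ℕ) (a : ℕ → ℂ) (β : ℝ) :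
    𝓕 (gw h s a) β = (∑ n ∈ s, a n * ee (β * n)) * ∫ u in (0:ℝ)..h, ee (-(β * u)) := by
  have hc : Continuous fun u : ℝ => ee (-(β * u)) := ee_cont.comp (by fun_prop)
  rw [Real.fourier_real_eq_integral_exp_smul]
  have e : ∀ v : ℝ, Complex.exp (↑(-2 * Real.pi * v * β) * Complex.I) • gw h s a v =
      ∑ n ∈ s, (Set.Ioo (-(n:ℝ)) (-(n:ℝ) + h)).indicator (fun v => ee (-(β * v)) * a n) v := by
    intro v
    have : Complex.exp (↑(-2 * Real.pi * v * β) * Complex.I) = ee (-(β * v)) := by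
      rw [ee_eq]; congr 3; ring
    rw [this, gw, smul_eq_mul, Finset.mul_sum]
    refine Finset.sum_congr rfl fun n _ => ?_
    by_cases hv : v ∈ Set.Ioo (-(n:ℝ)) (-(n:ℝ) + h) <;> simp [hv, Set.indicator]
  simp_rw [e]
  rw [integral_finsetSum, Finset.sum_mul]
  · refine Finset.sum_congr rfl fun n _ => ?_
    rw [integral_indicator measurableSet_Ioo, ← integral_Ioc_eq_integral_Ioo,
      ← intervalIntegral.integral_of_le (by linarith), intervalIntegral.integral_mul_const]
    have := intervalIntegral.integral_comp_add_right (a := 0) (b := h)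
      (fun v => ee (-(β * v))) (-(n:ℝ))
    rw [zero_add, add_comm h] at this
    rw [← this]
    have : ∀ u : ℝ, ee (-(β * (u + -(n:ℝ)))) = ee (-(β * u)) * ee (β * n) := by
      intro u; rw [← ee_add]; congr 1; ring
    simp_rw [this]
    rw [intervalIntegral.integral_mul_const]
    ring
  · intro n _
    rw [integrable_indicator_iff measurableSet_Ioo]
    exact ((hc.mul continuous_const).integrableOn_Icc).mono_set Set.Ioo_subset_Icc_self

lemma gw_window (Δ N N' : ℝ) (hN : 0 < N) (a : ℕ → ℂ) (t : ℝ) :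
    ∑ n ∈ Finset.Ioo ⌊max t N⌋₊ ⌈min (t + Δ / 2) N'⌉₊, a n
      = gw (Δ / 2) (Finset.Ioo ⌊N⌋₊ ⌈N'⌉₊) a (-t) := by
  unfold gw
  simp only [Set.indicator_apply]
  rw [← Finset.sum_filter]
  refine Finset.sum_congr ?_ fun _ _ => rfl
  ext n
  simp only [Finset.mem_Ioo, Finset.mem_filter, Set.mem_Ioo, Nat.lt_ceil,
    Nat.floor_lt hN.le, Nat.floor_lt (le_trans hN.le (le_max_right t N)), max_lt_iff, lt_min_iff]
  constructor
  · rintro ⟨⟨h1, h2⟩, h3, h4⟩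
    exact ⟨⟨h2, h4⟩, by linarith, by linarith⟩
  · rintro ⟨⟨h2, h4⟩, h1, h3⟩
    exact ⟨⟨by linarith, h2⟩, by linarith, h4⟩

theorem stmt8 :
    ∃ C > 0, ∀ Δ N N' : ℝ, 2 < Δ → Δ < N / 2 → N < N' → N' < 2 * N →
      ∀ a : ℕ → ℂ,
      (∫ β in Set.Ioo (-Δ⁻¹) Δ⁻¹,
          ‖∑ n ∈ Finset.Ioo ⌊N⌋₊ ⌈N'⌉₊, a n * ee (β * n)‖ ^ 2)
        ≤ C * Δ⁻¹ ^ 2 *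
          ∫ t in (N - Δ / 2)..N',
            ‖∑ n ∈ Finset.Ioo ⌊max t N⌋₊ ⌈min (t + Δ / 2) N'⌉₊, a n‖ ^ 2 := by
  refine ⟨16, by norm_num, ?_⟩
  intro Δ N N' hΔ hΔN hNN' _ a
  have hN : 0 < N := by linarith
  have hΔ0 : 0 < Δ := by linarith
  set s := Finset.Ioo ⌊N⌋₊ ⌈N'⌉₊ with hs
  simp_rw [gw_window Δ N N' hN a, ← hs]
  have hR : ∫ t in (N - Δ / 2)..N', ‖gw (Δ / 2) s a (-t)‖ ^ 2
      = ∫ t, ‖gw (Δ / 2) s a t‖ ^ 2 := by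
    rw [← integral_neg_eq_self (fun t => ‖gw (Δ / 2) s a t‖ ^ 2),
      intervalIntegral.integral_of_le (by linarith)]
    refine setIntegral_eq_integral_of_forall_compl_eq_zero fun t ht => ?_
    have : gw (Δ / 2) s a (-t) = 0 := by
      unfold gw
      refine Finset.sum_eq_zero fun n hn => Set.indicator_of_notMem ?_ _
      simp only [hs, Finset.mem_Ioo, Nat.lt_ceil, Nat.floor_lt hN.le] at hn
      rintro ⟨h1, h2⟩
      exact ht ⟨by linarith, by linarith⟩
    simp [this]
  obtain ⟨hi, hp⟩ := planch (gw (Δ / 2) s a)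
    (memLp_one_iff_integrable.1 (gw_memLp _ _ _ _)) (gw_memLp _ _ _ _)
  rw [hR, ← hp, ← integral_const_mul]
  have hi' := hi.const_mul (16 * Δ⁻¹ ^ 2)
  refine le_trans (setIntegral_mono_on ?_ hi'.integrableOn measurableSet_Ioo ?_)
    (setIntegral_le_integral hi' (Filter.Eventually.of_forall fun x => by positivity))
  · have hc : Continuous fun β : ℝ => ‖∑ n ∈ s, a n * ee (β * n)‖ ^ 2 := by
      have := ee_cont
      fun_prop
    exact hc.integrableOn_Icc.mono_set Set.Ioo_subset_Icc_self
  · intro β hβ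
    have hb : |β| * (Δ / 2) ≤ 1 / 2 := by
      have : |β| < Δ⁻¹ := abs_lt.2 hβ
      have : |β| * Δ ≤ Δ⁻¹ * Δ := by gcongr
      rw [inv_mul_cancel₀ hΔ0.ne'] at this
      linarith
    have hk := kernel_lower (Δ / 2) β (by linarith) hb
    rw [gw_fourier _ (by linarith), norm_mul, mul_pow]
    have hk2 : (Δ / 2 / 2) ^ 2 ≤ ‖∫ u in (0:ℝ)..(Δ / 2), ee (-(β * u))‖ ^ 2 := by gcongr
    set S := ‖∑ n ∈ s, a n * ee (β * n)‖ ^ 2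
    have hS : 0 ≤ S := by positivity
    calc S = 16 * Δ⁻¹ ^ 2 * (S * (Δ / 2 / 2) ^ 2) := by field_simp; norm_num
      _ ≤ _ := by gcongr
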